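/- Regard ℝ as a vector space over ℚ, let N be the ℚ-subspace of ℝ spanned by π, let Q = ℝ/N be the quotient ℚ-vector space, and let q : ℝ → Q be the quotient map. Define D(a) = arccos( cos a / (1 + 2 cos a) ). Then there exists a countable set E ⊆ ℝ such that for every a ∈ (0, arccos(−1/3)) with a ∉ E, one has q(a) ⊗ q(D(a)) ≠ q(D(a)) ⊗ q(a) in the tensor product Q ⊗_ℚ Q. In particular, there exists a ∈ (0, arccos(−1/3)) with q(a) ⊗ q(D(a)) ≠ q(D(a)) ⊗ q(a). -/

import Mathlib

open TensorProduct in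
/-- Two commuting vectors in a tensor square over a field are proportional. -/
theorem exists_smul_eq_of_tmul_comm {K V : Type*} [Field K] [AddCommGroup V] [Module K V]
    {x y : V} (hx : x ≠ 0) (h : x ⊗ₜ[K] y = y ⊗ₜ[K] x) : ∃ c : K, c • x = y := by
  obtain ⟨f, hf⟩ : ∃ f : Module.Dual K V, f x ≠ 0 := by
    by_contra! hf
    exact hx ((Module.forall_dual_apply_eq_zero_iff K x).1 hf)
  have h' : f x • y = f y • x := by
    simpa using congrArg (TensorProduct.lid K V ∘ f.rTensor V) h
  refine ⟨(f x)⁻¹ * f y, ?_⟩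
  rw [mul_smul, ← h', inv_smul_smul₀ hf]

/-- The zeros of an analytic function on a connected set form a countable set, unless the
function vanishes identically. -/
theorem AnalyticOnNhd.countable_zeros_of_preconnected {𝕜 E : Type*} [NontriviallyNormedField 𝕜]
    [SecondCountableTopology 𝕜] [NormedAddCommGroup E] [NormedSpace 𝕜 E] {f : 𝕜 → E} {U : Set 𝕜}
    (hf : AnalyticOnNhd 𝕜 f U) (hU : IsPreconnected U) (hne : ¬ Set.EqOn f 0 U) :
    (U ∩ {x | f x = 0}).Countable := by
  have h := (hf.eqOn_zero_or_eventually_ne_zero_of_preconnected hU).resolve_left hne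
  have hd : IsDiscrete ({x | f x = 0} ∩ U) := isDiscrete_of_codiscreteWithin h
  rw [Set.inter_comm]
  exact (HereditarilyLindelofSpace.isLindelof _).countable_of_isDiscrete hd

theorem Real.neg_one_third_lt_cos_of_abs_lt {a : ℝ} (ha : |a| < Real.arccos (-1 / 3)) :
    -1 / 3 < Real.cos a := by
  rw [← Real.cos_abs, ← Real.cos_arccos (x := -1 / 3) (by norm_num) (by norm_num)]
  exact Real.cos_lt_cos_of_nonneg_of_le_pi (abs_nonneg a) (Real.arccos_le_pi _) ha

theorem Real.pi_div_two_lt_arccos_neg_one_third : Real.pi / 2 < Real.arccos (-1 / 3) := by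
  rw [← Real.arccos_zero]
  exact Real.arccos_lt_arccos (by norm_num) (by norm_num) (by norm_num)

/-- The dihedral angle of the regular spherical tetrahedron of side length `a`. -/
noncomputable def sphericalDihedralAngle (a : ℝ) : ℝ :=
  Real.arccos (Real.cos a / (1 + 2 * Real.cos a))

theorem analyticOnNhd_sphericalDihedralAngle :
    AnalyticOnNhd ℝ sphericalDihedralAngle
      (Set.Ioo (-Real.arccos (-1 / 3)) (Real.arccos (-1 / 3))) := by
  intro a ha
  have hc := Real.neg_one_third_lt_cos_of_abs_lt (abs_lt.2 ha)
  have hpos : 0 < 1 + 2 * Real.cos a := by linarith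
  have hcos : AnalyticAt ℝ Real.cos a := Real.analyticAt_cos
  have harg : AnalyticAt ℝ (fun x ↦ Real.cos x / (1 + 2 * Real.cos x)) a :=
    hcos.fun_div (analyticAt_const.fun_add (analyticAt_const.fun_mul hcos)) hpos.ne'
  have harccos : AnalyticAt ℝ Real.arccos (Real.cos a / (1 + 2 * Real.cos a)) := by
    refine (Real.contDiffAt_arccos ?_ ?_).analyticAt
    · exact ((lt_div_iff₀ hpos).2 (by linarith)).ne'
    · exact ((div_lt_iff₀ hpos).2 (by linarith)).ne
  exact AnalyticAt.comp (g := Real.arccos) (f := fun x ↦ Real.cos x / (1 + 2 * Real.cos x))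
    harccos harg

theorem sphericalDihedralAngle_neg (a : ℝ) :
    sphericalDihedralAngle (-a) = sphericalDihedralAngle a := by
  simp [sphericalDihedralAngle]

theorem sphericalDihedralAngle_zero : sphericalDihedralAngle 0 = Real.arccos (1 / 3) := by
  norm_num [sphericalDihedralAngle]

theorem sphericalDihedralAngle_pi_div_two :
    sphericalDihedralAngle (Real.pi / 2) = Real.pi / 2 := by
  simp [sphericalDihedralAngle]

theorem countable_setOf_sphericalDihedralAngle_eq_affine (c d : ℝ) :
    (Set.Ioo (-Real.arccos (-1 / 3)) (Real.arccos (-1 / 3)) ∩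
      {a | sphericalDihedralAngle a - (c * a + d) = 0}).Countable := by
  refine AnalyticOnNhd.countable_zeros_of_preconnected
    (f := fun a ↦ sphericalDihedralAngle a - (c * a + d))
    (fun a ha ↦ (analyticOnNhd_sphericalDihedralAngle a ha).fun_sub
      ((analyticAt_const.fun_mul analyticAt_id).fun_add analyticAt_const))
    isPreconnected_Ioo fun h ↦ ?_
  have hlt := Real.pi_div_two_lt_arccos_neg_one_third
  have hpi := Real.pi_pos
  have h₀ := h (x := 0) ⟨by linarith, by linarith⟩
  have h₁ := h (x := Real.pi / 2) ⟨by linarith, hlt⟩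
  have h₂ := h (x := -(Real.pi / 2)) ⟨by linarith, by linarith⟩
  simp only [sphericalDihedralAngle_neg, sphericalDihedralAngle_zero,
    sphericalDihedralAngle_pi_div_two, Pi.zero_apply] at h₀ h₁ h₂
  have h₃ : Real.arccos (1 / 3) < Real.arccos 0 :=
    Real.arccos_lt_arccos (by norm_num) (by norm_num) (by norm_num)
  rw [Real.arccos_zero] at h₃
  linarith

open TensorProduct in
theorem countable_setOf_tmul_sphericalDihedralAngle_comm :
    {a ∈ Set.Ioo (0 : ℝ) (Real.arccos (-1 / 3)) |
      (Submodule.span ℚ ({Real.pi} : Set ℝ)).mkQ a ⊗ₜ[ℚ]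
          (Submodule.span ℚ ({Real.pi} : Set ℝ)).mkQ (sphericalDihedralAngle a) =
        (Submodule.span ℚ ({Real.pi} : Set ℝ)).mkQ (sphericalDihedralAngle a) ⊗ₜ[ℚ]
          (Submodule.span ℚ ({Real.pi} : Set ℝ)).mkQ a}.Countable := by
  refine ((Set.countable_range fun s : ℚ ↦ s • Real.pi).union
    (Set.countable_iUnion fun c : ℚ ↦ Set.countable_iUnion fun s : ℚ ↦
      countable_setOf_sphericalDihedralAngle_eq_affine c (s * Real.pi))).mono ?_
  rintro a ⟨⟨ha₀, ha₁⟩, h⟩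
  by_cases hx : (Submodule.span ℚ ({Real.pi} : Set ℝ)).mkQ a = 0
  · left
    rwa [Submodule.mkQ_apply, Submodule.Quotient.mk_eq_zero, Submodule.mem_span_singleton] at hx
  · right
    obtain ⟨c, hc⟩ := exists_smul_eq_of_tmul_comm hx h
    rw [← map_smul, eq_comm, Submodule.mkQ_apply, Submodule.mkQ_apply, Submodule.Quotient.eq,
      Submodule.mem_span_singleton] at hc
    obtain ⟨s, hs⟩ := hc
    simp only [Rat.smul_def] at hs
    refine Set.mem_iUnion₂.2 ⟨c, s, ⟨by linarith, ha₁⟩, ?_⟩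
    simp only [Set.mem_ofPred_eq]
    linarith


open TensorProduct in
/-- Non-cocommutativity of the spherical Dehn invariant: with
`D(a) = arccos (cos a / (1 + 2 cos a))` and `q : ℝ → ℝ/(π·ℚ)` the quotient
map, there is a countable set `E ⊆ ℝ` such that for every
`a ∈ (0, arccos (−1/3))` outside `E` one has
`q a ⊗ q (D a) ≠ q (D a) ⊗ q a` in `Q ⊗_ℚ Q`; in particular such an `a`
exists. -/
theorem dehn_invariant_not_cocommutative :
    ∃ E : Set ℝ, E.Countable ∧
      (∀ a ∈ Set.Ioo (0 : ℝ) (Real.arccos (-1/3)), a ∉ E →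
        (Submodule.span ℚ ({Real.pi} : Set ℝ)).mkQ a ⊗ₜ[ℚ]
            (Submodule.span ℚ ({Real.pi} : Set ℝ)).mkQ
              (Real.arccos (Real.cos a / (1 + 2 * Real.cos a))) ≠
          (Submodule.span ℚ ({Real.pi} : Set ℝ)).mkQ
              (Real.arccos (Real.cos a / (1 + 2 * Real.cos a))) ⊗ₜ[ℚ]
            (Submodule.span ℚ ({Real.pi} : Set ℝ)).mkQ a) ∧
      ∃ a ∈ Set.Ioo (0 : ℝ) (Real.arccos (-1/3)),
        (Submodule.span ℚ ({Real.pi} : Set ℝ)).mkQ a ⊗ₜ[ℚ]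
            (Submodule.span ℚ ({Real.pi} : Set ℝ)).mkQ
              (Real.arccos (Real.cos a / (1 + 2 * Real.cos a))) ≠
          (Submodule.span ℚ ({Real.pi} : Set ℝ)).mkQ
              (Real.arccos (Real.cos a / (1 + 2 * Real.cos a))) ⊗ₜ[ℚ]
            (Submodule.span ℚ ({Real.pi} : Set ℝ)).mkQ a := by
  have hcount := countable_setOf_tmul_sphericalDihedralAngle_comm
  refine ⟨_, hcount, fun a ha hE h ↦ hE ⟨ha, h⟩, ?_⟩
  by_contra! hall
  have hlt : (0 : ℝ) < Real.arccos (-1 / 3) :=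
    Real.pi_div_two_pos.trans Real.pi_div_two_lt_arccos_neg_one_third
  refine hlt.not_ge (Cardinal.Real.Ioo_countable_iff.1 (hcount.mono ?_))
  exact fun a ha ↦ ⟨ha, hall a ha⟩
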